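/- Let a, b be real with a > 0, b > 0 and a⁵ > 49·b⁵. If (x, y, z, w) is a singular point of the affine quintic and moreover w = conj(x) and z = conj(y) (i.e. the point is fixed by the anti-holomorphic involution ι : (x,y,z,w) ↦ (w̄, z̄, ȳ, x̄)), then x = y = z = w = 0. (Thus the special Lagrangian fixed-point locus meets the singular set of the quintic only at the origin.) -/

import Mathlib

/-- The auxiliary cubic `φ_c(u,v,t) = (u+v)^3 + 3uv(u+v) + c t^3`. -/
noncomputable def phi (c u v t : ℂ) : ℂ := (u + v) ^ 3 + 3 * u * v * (u + v) + c * t ^ 3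

/-- The quintic `F = xw φ_a(x,w,t) - yz φ_b(y,z,t)`. -/
noncomputable def F (a b : ℝ) (x y z w t : ℂ) : ℂ :=
  x * w * phi (a : ℂ) x w t - y * z * phi (b : ℂ) y z t

/-- `(x,y,z,w)` is a singular point of the affine quintic `F(·,·,·,·,1) = 0`. -/
def IsSingularPoint (a b : ℝ) (x y z w : ℂ) : Prop :=
  F a b x y z w 1 = 0 ∧
  deriv (fun s => F a b s y z w 1) x = 0 ∧
  deriv (fun s => F a b x s z w 1) y = 0 ∧
  deriv (fun s => F a b x y s w 1) z = 0 ∧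
  deriv (fun s => F a b x y z s 1) w = 0

/-- The partial derivative of `u v φ_c(u,v,1)` with respect to `u`, written out. -/
lemma hasDerivAt_mul_phi (c u v : ℂ) :
    HasDerivAt (fun s => s * v * phi c s v 1)
      (v * ((u + v) ^ 3 + 3 * u * v * (u + v) + c)
        + u * v * (3 * (u + v) ^ 2 + 3 * v * (u + v) + 3 * u * v)) u := by
  have hid := hasDerivAt_id' u
  have hsum := hid.add_const v
  have hphi := ((hsum.fun_pow 3).fun_add
    (((hid.const_mul 3).mul_const v).fun_mul hsum)).add_const (c * 1 ^ 3)
  unfold phi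
  refine ((hid.mul_const v).fun_mul hphi).congr_deriv ?_
  push_cast
  ring

lemma phi_comm (c u v t : ℂ) : phi c u v t = phi c v u t := by
  unfold phi
  ring

/-- A critical point of `u v φ_c(u,v,1)` on the locus `v = conj u` is real, and is either zero
or a cube root of `-c/35`. -/
lemma critical_point_conj (c : ℝ) (u v : ℂ) (hv : v = starRingEnd ℂ u)
    (h₁ : deriv (fun s => s * v * phi c s v 1) u = 0)
    (h₂ : deriv (fun s => u * s * phi c u s 1) v = 0) :
    ∃ r : ℝ, u = r ∧ v = r ∧ (r = 0 ∨ 35 * r ^ 3 = -c) := by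
  have hswap : (fun s => u * s * phi c u s 1) = fun s => s * u * phi c s u 1 := by
    funext s
    rw [phi_comm, mul_comm u s]
  rw [(hasDerivAt_mul_phi _ _ _).deriv] at h₁
  rw [hswap, (hasDerivAt_mul_phi _ _ _).deriv] at h₂
  obtain ⟨r, q⟩ := u
  have hu : (⟨r, q⟩ : ℂ) = r + q * Complex.I := Complex.mk_eq_add_mul_I r q
  have hv' : v = r - q * Complex.I := by
    rw [hv, hu]
    simp [sub_eq_add_neg]
  have hmul : (⟨r, q⟩ : ℂ) * v = ((r ^ 2 + q ^ 2 : ℝ) : ℂ) := by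
    rw [hu, hv']
    push_cast
    linear_combination -(q : ℂ) ^ 2 * Complex.I_sq
  have hadd : (⟨r, q⟩ : ℂ) + v = ((2 * r : ℝ) : ℂ) := by
    rw [hu, hv']
    push_cast
    ring
  have hsub : (⟨r, q⟩ : ℂ) - v = 2 * q * Complex.I := by
    rw [hu, hv']
    ring
  have hprod : (((r ^ 2 + q ^ 2) * ((2 * r) ^ 2 + (r ^ 2 + q ^ 2)) : ℝ) : ℂ) * q = 0 := by
    have hdiff : (⟨r, q⟩ * v) * (((⟨r, q⟩ : ℂ) + v) ^ 2 + ⟨r, q⟩ * v) * (⟨r, q⟩ - v) = 0 := by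
      linear_combination (-(1 / 3) * v) * h₂ + (1 / 3) * (⟨r, q⟩ : ℂ) * h₁
    rw [hmul, hadd, hsub] at hdiff
    push_cast at hdiff ⊢
    have hI : (2 * Complex.I) ≠ 0 := by simp
    apply mul_right_cancel₀ hI
    linear_combination hdiff
  have hq : q = 0 := by
    by_contra hq
    have hpos : 0 < q ^ 2 := by positivity
    have hne : (r ^ 2 + q ^ 2) * ((2 * r) ^ 2 + (r ^ 2 + q ^ 2)) * q ≠ 0 := by positivity
    exact hne (by exact_mod_cast hprod)
  subst hq
  have hu' : (⟨r, 0⟩ : ℂ) = r := rfl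
  have hv'' : v = r := by simpa using hv'
  refine ⟨r, hu', hv'', ?_⟩
  rw [hu', hv''] at h₁
  have hcrit : r * (35 * r ^ 3 + c) = 0 := by
    have : (r : ℂ) * (35 * r ^ 3 + c) = 0 := by linear_combination h₁
    exact_mod_cast this
  rcases mul_eq_zero.mp hcrit with h | h
  · exact Or.inl h
  · exact Or.inr (by linarith)

/-- If `a, b > 0` and `a⁵ > 49 b⁵`, the only singular point of the affine
quintic fixed by the anti-holomorphic involution `(x,y,z,w) ↦ (w̄,z̄,ȳ,x̄)`
(i.e. with `w = x̄` and `z = ȳ`) is the origin. -/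
theorem fixed_singular_point_is_origin (a b : ℝ) (ha : 0 < a) (hb : 0 < b)
    (hab : a ^ 5 > 49 * b ^ 5) (x y z w : ℂ)
    (h : IsSingularPoint a b x y z w)
    (hw : w = starRingEnd ℂ x) (hz : z = starRingEnd ℂ y) :
    x = 0 ∧ y = 0 ∧ z = 0 ∧ w = 0 := by
  obtain ⟨h0, hx, hy, hz', hw'⟩ := h
  simp only [F, deriv_sub_const, deriv_const_sub, neg_eq_zero] at hx hy hz' hw'
  obtain ⟨r, rfl, rfl, hr⟩ := critical_point_conj a x w hw hx hw'
  obtain ⟨s, rfl, rfl, hs⟩ := critical_point_conj b y z hz hy hz'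
  have hval : r ^ 2 * (14 * r ^ 3 + a) = s ^ 2 * (14 * s ^ 3 + b) := by
    have : (r : ℂ) ^ 2 * (14 * r ^ 3 + a) = s ^ 2 * (14 * s ^ 3 + b) := by
      unfold F phi at h0
      linear_combination h0
    exact_mod_cast this
  have hr' : r ^ 2 * (14 * r ^ 3 + a) = 3 / 5 * a * r ^ 2 := by
    rcases hr with hr | hr
    · simp [hr]
    · linear_combination (2 / 5) * r ^ 2 * hr
  have hs' : s ^ 2 * (14 * s ^ 3 + b) = 3 / 5 * b * s ^ 2 := by
    rcases hs with hs | hs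
    · simp [hs]
    · linear_combination (2 / 5) * s ^ 2 * hs
  have heq : a * r ^ 2 = b * s ^ 2 := by linarith
  have hiff : r = 0 ↔ s = 0 := by
    constructor
    · rintro rfl
      simpa [hb.ne'] using heq.symm
    · rintro rfl
      simpa [ha.ne'] using heq
  have hr0 : r = 0 := by
    by_contra hne
    have hr3 := hr.resolve_left hne
    have hs3 := hs.resolve_left (mt hiff.mpr hne)
    have hcube : (a * r ^ 2) ^ 3 = (b * s ^ 2) ^ 3 := by rw [heq]
    have hr6 : (35 * r ^ 3) ^ 2 = a ^ 2 := by rw [hr3, neg_sq]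
    have hs6 : (35 * s ^ 3) ^ 2 = b ^ 2 := by rw [hs3, neg_sq]
    have hpow : a ^ 5 = b ^ 5 := by
      linear_combination 1225 * hcube - a ^ 3 * hr6 + b ^ 3 * hs6
    have hb5 : 0 < b ^ 5 := by positivity
    linarith
  have hs0 : s = 0 := hiff.mp hr0
  simp [hr0, hs0]
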